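/- arXiv:2003.13761 — 4 statements merged into one kernel-verified Lean document; each statement's English description precedes it below -/
import Mathlib

section
/- Let E be a real normed vector space, let γ, τ be positive integers, let η ≥ 0 and G ≥ 0. Consider two sequences θ, θ' : ℕ → E with θ 0 = θ' 0, evolving by θ(s+1) = θ(s) − η·u(s) and θ'(s+1) = θ'(s) − η·u'(s) for s = 0, …, τ−1, where for each s the update directions are mini-batch averages u(s) = (1/γ) ∑_{j : Fin γ} v_s(j) and u'(s) = (1/γ) ∑_{j : Fin γ} v'_s(j) of per-sample gradient vectors satisfying ‖v_s(j)‖ ≤ G and ‖v'_s(j)‖ ≤ G for all j, with v_s(j) = v'_s(j) for all j except possibly one index per step. Then ‖θ(τ) − θ'(τ)‖ ≤ 2ητG/γ. (This is the sensitivity bound for the local model after τ local SGD iterations.) -/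
/-- Two families bounded by `G` in norm that agree off one index have sums at distance at most
`2 * G`. -/
theorem norm_sum_sub_sum_le_of_eq_off_singleton
    {ι E : Type*} [Fintype ι] [SeminormedAddCommGroup E] {G : ℝ} {v v' : ι → E} (j₀ : ι)
    (hv : ‖v j₀‖ ≤ G) (hv' : ‖v' j₀‖ ≤ G) (h : ∀ j, j ≠ j₀ → v j = v' j) :
    ‖∑ j, v j - ∑ j, v' j‖ ≤ 2 * G := by
  rw [← Finset.sum_sub_distrib,
    Fintype.sum_eq_single j₀ fun j hj => sub_eq_zero.2 (h j hj)]
  linarith [norm_sub_le (v j₀) (v' j₀)]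

/-- sensitivity bound `2ητG/γ` for the local model after `τ` local SGD
iterations with step size `η`, mini-batch size `γ`, and per-sample gradients of norm
at most `G`, when the two executions differ in at most one sample per mini-batch. -/
theorem local_model_sensitivity
    {E : Type*} [NormedAddCommGroup E] [NormedSpace ℝ E]
    (γ τ : ℕ) (hγ : 0 < γ) (hτ : 0 < τ)
    (η G : ℝ) (hη : 0 ≤ η) (hG : 0 ≤ G)
    (θ θ' : ℕ → E) (v v' : ℕ → Fin γ → E)
    (h0 : θ 0 = θ' 0)
    (hstep : ∀ s < τ, θ (s + 1) = θ s - η • ((1 / (γ : ℝ)) • ∑ j, v s j))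
    (hstep' : ∀ s < τ, θ' (s + 1) = θ' s - η • ((1 / (γ : ℝ)) • ∑ j, v' s j))
    (hv : ∀ s < τ, ∀ j, ‖v s j‖ ≤ G) (hv' : ∀ s < τ, ∀ j, ‖v' s j‖ ≤ G)
    (hdiff : ∀ s < τ, ∃ j₀ : Fin γ, ∀ j, j ≠ j₀ → v s j = v' s j) :
    ‖θ τ - θ' τ‖ ≤ 2 * η * τ * G / γ := by
  have bound : ∀ s ≤ τ, ‖θ s - θ' s‖ ≤ 2 * η * s * G / γ := by
    intro s
    induction s with
    | zero => simp [h0]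
    | succ s ih =>
      intro hs
      have hs' : s < τ := hs
      obtain ⟨j₀, hj₀⟩ := hdiff s hs'
      have hsum := norm_sum_sub_sum_le_of_eq_off_singleton j₀ (hv s hs' j₀) (hv' s hs' j₀) hj₀
      have hsplit : θ (s + 1) - θ' (s + 1) =
          (θ s - θ' s) - (η * (1 / (γ : ℝ))) • (∑ j, v s j - ∑ j, v' s j) := by
        rw [hstep s hs', hstep' s hs', smul_smul, smul_smul, smul_sub]
        abel
      calc ‖θ (s + 1) - θ' (s + 1)‖
          ≤ ‖θ s - θ' s‖ + η * (1 / (γ : ℝ)) * ‖∑ j, v s j - ∑ j, v' s j‖ := by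
            rw [hsplit]
            refine (norm_sub_le _ _).trans_eq ?_
            rw [norm_smul, Real.norm_of_nonneg (by positivity)]
        _ ≤ 2 * η * s * G / γ + η * (1 / (γ : ℝ)) * (2 * G) := by
            gcongr
            exact ih hs'.le
        _ = 2 * η * (s + 1 : ℕ) * G / γ := by
            push_cast
            ring
  exact bound τ le_rfl
end

section
/- Let σ > 0, let μ, ν ∈ ℝ, and let α ∈ ℝ with α > 1. Let p_μ and p_ν denote the probability density functions of the real Gaussian distributions N(μ, σ²) and N(ν, σ²) respectively. Then ∫_ℝ (p_μ x)^α · (p_ν x)^{1−α} dx = exp( α(α−1)(μ−ν)² / (2σ²) ). Equivalently, the expected value under N(μ, σ²) of exp((α−1)·Z), where Z(x) = log(p_μ(x)/p_ν(x)) is the privacy loss, equals exp(α(α−1)(μ−ν)²/(2σ²)). -/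
open Real

/-- The probability density function of the real Gaussian distribution `N(μ, σ²)`. -/
noncomputable def gaussPDF (μ σ x : ℝ) : ℝ :=
  (1 / (σ * Real.sqrt (2 * Real.pi))) * Real.exp (-((x - μ) ^ 2) / (2 * σ ^ 2))

theorem gaussPDF_eq_gaussianPDFReal (μ x : ℝ) {σ : ℝ} (hσ : 0 ≤ σ) :
    gaussPDF μ σ x = ProbabilityTheory.gaussianPDFReal μ (.mk (σ ^ 2) (sq_nonneg σ)) x := by
  simp only [gaussPDF, ProbabilityTheory.gaussianPDFReal, NNReal.coe_mk, one_div]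
  rw [Real.sqrt_mul (by positivity) (σ ^ 2), Real.sqrt_sq hσ, mul_comm σ]

theorem integral_gaussPDF_eq_one (μ : ℝ) {σ : ℝ} (hσ : 0 < σ) :
    ∫ x : ℝ, gaussPDF μ σ x = 1 := by
  simp only [gaussPDF_eq_gaussianPDFReal μ _ hσ.le]
  refine ProbabilityTheory.integral_gaussianPDFReal_eq_one μ fun h => ?_
  exact (pow_pos hσ 2).ne' (congrArg NNReal.toReal h)

theorem gaussPDF_rpow_mul_rpow (μ ν α x : ℝ) {σ : ℝ} (hσ : 0 < σ) :
    gaussPDF μ σ x ^ α * gaussPDF ν σ x ^ (1 - α)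
      = Real.exp (α * (α - 1) * (μ - ν) ^ 2 / (2 * σ ^ 2))
        * gaussPDF (α * μ + (1 - α) * ν) σ x := by
  have hc : 0 < 1 / (σ * √(2 * π)) := by positivity
  simp only [gaussPDF]
  rw [Real.mul_rpow hc.le (Real.exp_nonneg _), Real.mul_rpow hc.le (Real.exp_nonneg _),
    mul_mul_mul_comm, ← Real.rpow_add hc, add_sub_cancel, Real.rpow_one, ← Real.exp_mul,
    ← Real.exp_mul, ← Real.exp_add, mul_left_comm, ← Real.exp_add]
  congr 2
  ring

/-- the privacy-loss moment of the one-dimensional Gaussian mechanism: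
`∫ p_μ(x)^α p_ν(x)^{1-α} dx = exp(α(α-1)(μ-ν)²/(2σ²))`. -/
theorem gaussian_renyi_moment (σ μ ν α : ℝ) (hσ : 0 < σ) (hα : 1 < α) :
    ∫ x : ℝ, (gaussPDF μ σ x) ^ α * (gaussPDF ν σ x) ^ (1 - α)
      = Real.exp (α * (α - 1) * (μ - ν) ^ 2 / (2 * σ ^ 2)) := by
  simp only [gaussPDF_rpow_mul_rpow μ ν α _ hσ]
  rw [MeasureTheory.integral_const_mul, integral_gaussPDF_eq_one _ hσ, mul_one]
end

section
/- Let (Ω, F, P) be a probability space, let ρ > 0 and δ ∈ (0, 1), and let Z : Ω → ℝ be a random variable such that for every real α > 1, E[exp((α−1)·Z)] ≤ exp(α(α−1)ρ). Then P( Z ≥ ρ + 2·√(ρ · log(1/δ)) ) ≤ δ. (Conversion from zCDP to (ε, δ)-DP: a ρ-zCDP mechanism is (ρ + 2√(ρ log(1/δ)), δ)-differentially private.) -/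
open MeasureTheory ProbabilityTheory

/-- conversion from zCDP to `(ε, δ)`-DP: if the privacy-loss random
variable `Z` satisfies `E[e^{(α-1)Z}] ≤ e^{α(α-1)ρ}` for all `α > 1`, then
`P(Z ≥ ρ + 2√(ρ log(1/δ))) ≤ δ`. -/
theorem zCDP_to_DP
    {Ω : Type*} [MeasurableSpace Ω] (P : Measure Ω) [IsProbabilityMeasure P]
    (ρ δ : ℝ) (hρ : 0 < ρ) (hδ0 : 0 < δ) (hδ1 : δ < 1)
    (Z : Ω → ℝ) (hmeas : Measurable Z)
    (hZ : ∀ α : ℝ, 1 < α →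
      ∫⁻ ω, ENNReal.ofReal (Real.exp ((α - 1) * Z ω)) ∂P
        ≤ ENNReal.ofReal (Real.exp (α * (α - 1) * ρ))) :
    P {ω | ρ + 2 * Real.sqrt (ρ * Real.log (1 / δ)) ≤ Z ω} ≤ ENNReal.ofReal δ := by
  set L := Real.log (1 / δ) with hL
  have hL0 : 0 < L := Real.log_pos (one_lt_one_div hδ0 hδ1)
  have hexpL : Real.exp (-L) = δ := by
    rw [hL, one_div, Real.log_inv, neg_neg, Real.exp_log hδ0]
  set s := Real.sqrt (ρ * L)
  have hs : 0 < s := Real.sqrt_pos.mpr (mul_pos hρ hL0)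
  have hs2 : s ^ 2 = ρ * L := Real.sq_sqrt (mul_pos hρ hL0).le
  set t := s / ρ with ht
  have ht0 : 0 < t := div_pos hs hρ
  have hexponent : (t + 1) * t * ρ - t * (ρ + 2 * s) = -L := by
    rw [ht]
    field_simp
    linear_combination -hs2
  have hmgf := hZ (t + 1) (by linarith)
  rw [add_sub_cancel_right] at hmgf
  calc P {ω | ρ + 2 * s ≤ Z ω}
      ≤ P {ω | ENNReal.ofReal (Real.exp (t * (ρ + 2 * s)))
          ≤ ENNReal.ofReal (Real.exp (t * Z ω))} := by
        refine measure_mono fun ω (hω : ρ + 2 * s ≤ Z ω) => ?_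
        exact ENNReal.ofReal_le_ofReal
          (Real.exp_le_exp.mpr (mul_le_mul_of_nonneg_left hω ht0.le))
    _ ≤ (∫⁻ ω, ENNReal.ofReal (Real.exp (t * Z ω)) ∂P)
          / ENNReal.ofReal (Real.exp (t * (ρ + 2 * s))) :=
        meas_ge_le_lintegral_div (by fun_prop)
          (ENNReal.ofReal_pos.mpr (Real.exp_pos _)).ne' ENNReal.ofReal_ne_top
    _ ≤ ENNReal.ofReal (Real.exp ((t + 1) * t * ρ))
          / ENNReal.ofReal (Real.exp (t * (ρ + 2 * s))) := by gcongr
    _ = ENNReal.ofReal δ := by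
        rw [← ENNReal.ofReal_div_of_pos (Real.exp_pos _), ← Real.exp_sub, hexponent, hexpL]
end

section
/- Let E be a real inner product space, let n, r be positive integers with r ≤ n, and let v : Fin n → E with average v̄ = (1/n) ∑_i v i. Then (1 / C(n, r)) · ∑_{Ω ⊆ Fin n, |Ω| = r} ‖ (1/r) ∑_{i ∈ Ω} v i − v̄ ‖² ≤ (4(n − r)² / n³) · ∑_{i} ‖v i‖², where C(n, r) = n choose r. (Variance bound for uniform sampling of r devices out of n without replacement.) -/
open Finset in
/-- Number of `(k + 1)`-subsets of an `(m + 2)`-element type containing both `i` and `j`. -/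
theorem card_filter_powersetCard_mem_mem {ι : Type*} [Fintype ι] [DecidableEq ι] {m : ℕ} (k : ℕ)
    (hι : Fintype.card ι = m + 2) (i j : ι) :
    (#{Ω ∈ powersetCard (k + 1) (univ : Finset ι) | i ∈ Ω ∧ j ∈ Ω} : ℝ) =
      (if i = j then (m.choose k : ℝ) else 0) + (((m + 1).choose k : ℝ) - m.choose k) := by
  have hfilter : {Ω ∈ powersetCard (k + 1) (univ : Finset ι) | i ∈ Ω ∧ j ∈ Ω} =
      {Ω ∈ powersetCard (k + 1) (univ : Finset ι) | {i, j} ⊆ Ω} := by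
    simp only [insert_subset_iff, singleton_subset_iff]
  rw [hfilter]
  split_ifs with hij
  · subst hij
    rw [card_filter_powersetCard_subset _ _ _ (subset_univ _) (by simp)]
    simp [hι]
  · have hpair : #({i, j} : Finset ι) = 2 := card_pair hij
    cases k with
    | zero =>
      have hempty : {Ω ∈ powersetCard (0 + 1) (univ : Finset ι) | {i, j} ⊆ Ω} = ∅ := by
        refine filter_eq_empty_iff.2 fun Ω hΩ hsub ↦ ?_
        have hle := card_le_card hsub
        rw [hpair, (mem_powersetCard.1 hΩ).2] at hle
        lia
      simp [hempty]
    | succ k =>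
      rw [card_filter_powersetCard_subset _ _ _ (subset_univ _) (by lia), hpair, card_univ, hι,
        Nat.choose_succ_succ m k]
      simp

open Finset in
/-- Second moment of the sum over a `(k + 1)`-subset of a family with vanishing total. -/
theorem sum_powersetCard_norm_sum_sq {ι E : Type*} [Fintype ι] [NormedAddCommGroup E]
    [InnerProductSpace ℝ E] {m : ℕ} (k : ℕ) (hι : Fintype.card ι = m + 2) (w : ι → E)
    (hw : ∑ i, w i = 0) :
    ∑ Ω ∈ powersetCard (k + 1) (univ : Finset ι), ‖∑ i ∈ Ω, w i‖ ^ 2 =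
      m.choose k * ∑ i, ‖w i‖ ^ 2 := by
  classical
  have hexpand (Ω : Finset ι) : ‖∑ i ∈ Ω, w i‖ ^ 2 =
      ∑ i, ∑ j, if i ∈ Ω ∧ j ∈ Ω then inner ℝ (w i) (w j) else 0 := by
    rw [← real_inner_self_eq_norm_sq, sum_inner]
    simp only [inner_sum, ite_and, sum_ite_irrel, sum_const_zero, sum_ite_mem, univ_inter]
  have htotal : ∑ i, ∑ j, inner ℝ (w i) (w j) = 0 := by
    simp only [← inner_sum, hw, inner_zero_right, sum_const_zero]
  simp_rw [hexpand]
  rw [sum_comm]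
  have hcount (i j : ι) : ∑ Ω ∈ powersetCard (k + 1) (univ : Finset ι),
      (if i ∈ Ω ∧ j ∈ Ω then inner ℝ (w i) (w j) else 0) =
      (if i = j then (m.choose k : ℝ) * inner ℝ (w i) (w j) else 0) +
        (((m + 1).choose k : ℝ) - m.choose k) * inner ℝ (w i) (w j) := by
    rw [← sum_filter, sum_const, nsmul_eq_mul, card_filter_powersetCard_mem_mem k hι, add_mul,
      ite_mul, zero_mul]
  simp_rw [sum_comm (s := powersetCard (k + 1) (univ : Finset ι)), hcount, sum_add_distrib,
    ← mul_sum, htotal]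
  simp [mul_sum]

/-- Centering a family does not increase its sum of squared norms. -/
theorem sum_norm_sub_average_sq_le {ι E : Type*} [Fintype ι] [Nonempty ι] [NormedAddCommGroup E]
    [InnerProductSpace ℝ E] (v : ι → E) :
    ∑ i, ‖v i - (1 / (Fintype.card ι : ℝ)) • ∑ j, v j‖ ^ 2 ≤ ∑ i, ‖v i‖ ^ 2 := by
  have hcard : (0 : ℝ) < Fintype.card ι := by exact_mod_cast Fintype.card_pos
  have hnonneg : 0 ≤ 1 / (Fintype.card ι : ℝ) * ‖∑ j, v j‖ ^ 2 := by positivity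
  simp_rw [norm_sub_sq_real, Finset.sum_add_distrib, Finset.sum_sub_distrib, ← Finset.mul_sum,
    ← sum_inner, inner_smul_right, real_inner_self_eq_norm_sq, norm_smul, Finset.sum_const,
    Finset.card_univ, nsmul_eq_mul, mul_pow, Real.norm_eq_abs, sq_abs]
  have hcancel : (Fintype.card ι : ℝ) * ((1 / (Fintype.card ι : ℝ)) ^ 2 * ‖∑ j, v j‖ ^ 2) =
      1 / (Fintype.card ι : ℝ) * ‖∑ j, v j‖ ^ 2 := by
    field_simp
  linarith

theorem succ_mul_choose_mul_sub (m k : ℕ) (hkm : k ≤ m) :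
    ((m : ℝ) + 2) * (m + 1) * m.choose k =
      (k + 1) * (m + 1 - k) * (m + 2).choose (k + 1) := by
  have h₁ : (m.choose k : ℝ) * (m + 1) = (m + 1).choose k * (m + 1 - k) := by
    have h := Nat.choose_mul_succ_eq m k
    rify [show k ≤ m + 1 by lia] at h
    exact h
  have h₂ : ((m : ℝ) + 2) * (m + 1).choose k = (m + 2).choose (k + 1) * (k + 1) := by
    have h := Nat.add_one_mul_choose_eq (m + 1) k
    rify at h
    rw [← h]
    ring
  linear_combination ((m : ℝ) + 2) * h₁ + ((m : ℝ) + 1 - k) * h₂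

/-- variance bound for sampling `r` devices out of `n` uniformly
without replacement: the average over all `r`-subsets `Ω` of the squared deviation of
the subset-average from the global average is at most `(4(n-r)²/n³) ∑ i, ‖v i‖²`. -/
theorem subset_average_variance_bound
    {E : Type*} [NormedAddCommGroup E] [InnerProductSpace ℝ E]
    (n r : ℕ) (hn : 0 < n) (hr : 0 < r) (hrn : r ≤ n) (v : Fin n → E) :
    (1 / (Nat.choose n r : ℝ)) *
        ∑ Ω ∈ Finset.powersetCard r (Finset.univ : Finset (Fin n)),
          ‖(1 / (r : ℝ)) • ∑ i ∈ Ω, v i - (1 / (n : ℝ)) • ∑ i, v i‖ ^ 2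
      ≤ (4 * ((n : ℝ) - r) ^ 2 / (n : ℝ) ^ 3) * ∑ i, ‖v i‖ ^ 2 := by
  obtain ⟨k, rfl⟩ : ∃ k, r = k + 1 := ⟨r - 1, by lia⟩
  obtain rfl | hlt := hrn.eq_or_lt
  · have hself : Finset.powersetCard (k + 1) (Finset.univ : Finset (Fin (k + 1))) =
        {Finset.univ} := by
      simpa using Finset.powersetCard_self (Finset.univ : Finset (Fin (k + 1)))
    simp [hself]
  obtain ⟨m, rfl⟩ : ∃ m, n = m + 2 := ⟨n - 2, by lia⟩
  have hkm : k ≤ m := by lia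
  set a : E := (1 / ((m + 2 : ℕ) : ℝ)) • ∑ i, v i with ha
  have hcentered : ∑ i, (v i - a) = 0 := by
    rw [Finset.sum_sub_distrib, Finset.sum_const, Finset.card_univ, Fintype.card_fin, ha,
      ← Nat.cast_smul_eq_nsmul ℝ, smul_smul, mul_one_div_cancel (by positivity), one_smul, sub_self]
  have hdev : ∀ Ω ∈ Finset.powersetCard (k + 1) (Finset.univ : Finset (Fin (m + 2))),
      ‖(1 / ((k + 1 : ℕ) : ℝ)) • ∑ i ∈ Ω, v i - a‖ ^ 2 =
        (1 / ((k + 1 : ℕ) : ℝ)) ^ 2 * ‖∑ i ∈ Ω, (v i - a)‖ ^ 2 := by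
    intro Ω hΩ
    rw [Finset.sum_sub_distrib, Finset.sum_const, (Finset.mem_powersetCard.1 hΩ).2,
      ← sq_abs (1 / ((k + 1 : ℕ) : ℝ)), ← mul_pow, ← Real.norm_eq_abs, ← norm_smul, smul_sub,
      ← Nat.cast_smul_eq_nsmul ℝ, smul_smul, one_div_mul_cancel (by positivity), one_smul]
  have hle : ∑ i, ‖v i - a‖ ^ 2 ≤ ∑ i, ‖v i‖ ^ 2 := by
    simpa only [Fintype.card_fin] using sum_norm_sub_average_sq_le v
  rw [Finset.sum_congr rfl hdev, ← Finset.mul_sum,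
    sum_powersetCard_norm_sum_sq k (Fintype.card_fin _) _ hcentered, ← mul_assoc, ← mul_assoc]
  refine mul_le_mul ?_ hle (by positivity) (by positivity)
  have hchoose : (0 : ℝ) < (m + 2).choose (k + 1) := by
    exact_mod_cast Nat.choose_pos hrn
  have hkm' : (k : ℝ) ≤ m := by exact_mod_cast hkm
  have hk : (0 : ℝ) ≤ k := k.cast_nonneg
  have hratio : (m.choose k : ℝ) =
      (k + 1) * (m + 1 - k) * (m + 2).choose (k + 1) / ((m + 2) * (m + 1)) := by
    rw [eq_div_iff (by positivity), ← succ_mul_choose_mul_sub m k hkm]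
    ring
  have hgap : (0 : ℝ) < m + 1 - k := by linarith
  have hvariance : 1 / ((m + 2).choose (k + 1) : ℝ) * (1 / ((k + 1 : ℕ) : ℝ)) ^ 2 * m.choose k =
      (m + 1 - k) / ((k + 1) * ((m + 2) * (m + 1))) := by
    rw [hratio]
    push_cast
    field_simp
  rw [hvariance]
  push_cast
  rw [div_le_div_iff₀ (by positivity) (by positivity)]
  have hprod : (m : ℝ) + 1 ≤ (k + 1) * (m + 1 - k) := by nlinarith
  have hkey : ((m : ℝ) + 2) ^ 2 ≤ 4 * (m + 1) * ((k + 1) * (m + 1 - k)) := by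
    nlinarith [mul_le_mul_of_nonneg_left hprod (by positivity : (0 : ℝ) ≤ 4 * (m + 1))]
  calc ((m : ℝ) + 1 - k) * (m + 2) ^ 3 = ((m : ℝ) + 1 - k) * (m + 2) * (m + 2) ^ 2 := by ring
    _ ≤ ((m : ℝ) + 1 - k) * (m + 2) * (4 * (m + 1) * ((k + 1) * (m + 1 - k))) := by gcongr
    _ = 4 * ((m : ℝ) + 2 - (k + 1)) ^ 2 * ((k + 1) * ((m + 2) * (m + 1))) := by ring
end
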